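/- Let K be a totally real number field of degree n ≥ 12 over ℚ, with discriminant Δ_K and regulator R_K. Then the number n_K of homothety classes of perfect unary forms over K satisfies n_K ≤ exp(n·√(η² + ρ)) · |Δ_K| · (2/π)^{2n} · Γ(2 + n/2)^4, where η = (√(n-1)/2) · (2/π)^{n-1} · Γ(2 + (n-1)/2)² · ( √(2/n) · (1/1000) · ((log log n)/(log n))³ )^{2-n} · R_K and ρ = (4/(n-1)) · ( log( n^{-n/2} · √|Δ_K| · (2/π)^{n/2} · Γ(2 + n/2) ) )². -/

import Mathlib

open NumberField Real

/-- An element of a number field is *totally positive* if it is positive under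
every real embedding. -/
def TotPos {K : Type*} [Field K] (a : K) : Prop := ∀ φ : K →+* ℝ, 0 < φ a

/-- The value of the trace form `Tr_{K/ℚ}(a x²)` at an algebraic integer `x`. -/
noncomputable def trForm {K : Type*} [Field K] [NumberField K] (a : K) (x : 𝓞 K) : ℚ :=
  Algebra.trace ℚ K (a * (x : K) ^ 2)

/-- `μ(a)`: the minimum of `Tr_{K/ℚ}(a x²)` over nonzero `x ∈ 𝓞 K`. -/
noncomputable def muMin {K : Type*} [Field K] [NumberField K] (a : K) : ℝ :=
  sInf {t : ℝ | ∃ x : 𝓞 K, x ≠ 0 ∧ (trForm a x : ℝ) = t}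

/-- `M(a)`: the set of algebraic integers attaining `μ(a)`. -/
def MinVecs {K : Type*} [Field K] [NumberField K] (a : K) : Set (𝓞 K) :=
  {x | ((trForm a x : ℚ) : ℝ) = muMin a}

/-- A totally positive `a` is *perfect* if it is the unique totally positive element `b`
with `Tr(b x²) = μ(a)` for all `x ∈ M(a)`. -/
def IsPerfectForm {K : Type*} [Field K] [NumberField K] (a : K) : Prop :=
  TotPos a ∧ ∀ b : K, TotPos b → (∀ x ∈ MinVecs a, ((trForm b x : ℚ) : ℝ) = muMin a) → b = a

/-- `a ~ a'` : equivalence by squares of units. -/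
def UnitEquiv {K : Type*} [Field K] [NumberField K] (a a' : K) : Prop :=
  ∃ u : (𝓞 K)ˣ, a' = a * ((u : 𝓞 K) : K) ^ 2

/-- Homothety: `a` and `b` are homothetic if `λ a ~ b` for some positive rational `λ`. -/
def Homothetic {K : Type*} [Field K] [NumberField K] (a b : K) : Prop :=
  ∃ q : ℚ, 0 < q ∧ UnitEquiv ((q : K) * a) b

/-- The number of homothety classes of perfect unary forms of `K`. -/
noncomputable def numClasses (K : Type*) [Field K] [NumberField K] : ℕ :=
  Nat.card (Quot (fun a b : {a : K // IsPerfectForm a} => Homothetic (a : K) (b : K)))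

/-- `K` is `A`-reducible if minimal vectors of totally positive elements have norm at most `A`. -/
def IsAReducible (K : Type*) [Field K] [NumberField K] (A : ℝ) : Prop :=
  ∀ a : K, TotPos a → ∀ x ∈ MinVecs a, |(Algebra.norm ℚ (x : K) : ℝ)| ≤ A

/-- `K` is totally real if every infinite place is real. -/
def TotallyReal (K : Type*) [Field K] [NumberField K] : Prop :=
  ∀ v : NumberField.InfinitePlace K, v.IsReal

open MeasureTheory in
/-- Balls centred at points whose distances to a lattice are spaced by `δ` pack into the torus. -/
theorem ZLattice.pow_card_mul_le_covolume {ι : Type*} [Fintype ι]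
    (L : Submodule ℤ (ι → ℝ)) [DiscreteTopology L] [IsZLattice ℝ L] {δ : ℝ} (hδ : 0 < δ)
    (hL : ∀ l ∈ L, l ≠ 0 → δ ≤ ‖l‖) (v : ι → ℝ) (m : ℕ)
    (hm : m * δ ≤ Metric.infDist v (L : Set (ι → ℝ))) :
    (m + 1) * δ ^ Fintype.card ι ≤ ZLattice.covolume L := by
  classical
  set d : (ι → ℝ) → ℝ := fun x ↦ Metric.infDist x (L : Set (ι → ℝ)) with hd
  have hd0 : d 0 = 0 := Metric.infDist_zero_of_mem L.zero_mem
  have hdc : ContinuousOn (fun t : ℝ ↦ d (t • v)) (Set.Icc 0 1) :=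
    ((Metric.continuous_infDist_pt _).comp (by fun_prop)).continuousOn
  have hpt : ∀ k : Fin (m + 1), ∃ p, d p = (k : ℝ) * δ := by
    intro k
    have hk : (k : ℝ) * δ ∈ Set.Icc (d ((0 : ℝ) • v)) (d ((1 : ℝ) • v)) := by
      rw [zero_smul, one_smul, hd0]
      refine ⟨by positivity, le_trans ?_ hm⟩
      have : (k : ℝ) ≤ m := by exact_mod_cast Nat.lt_succ_iff.mp k.2
      gcongr
    obtain ⟨t, -, ht⟩ := intermediate_value_Icc zero_le_one hdc hk
    exact ⟨_, ht⟩
  choose p hp using hpt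
  have hdadd : ∀ x, ∀ l ∈ L, d (l + x) ≤ d x := by
    intro x l hl
    refine le_of_forall_pos_lt_add fun ε hε ↦ ?_
    obtain ⟨y, hy, hxy⟩ := (Metric.infDist_lt_iff (⟨0, L.zero_mem⟩ : (L : Set (ι → ℝ)).Nonempty)).mp
      (lt_add_of_pos_right (d x) hε)
    exact (Metric.infDist_lt_iff ⟨0, L.zero_mem⟩).mpr
      ⟨l + y, L.add_mem hl hy, by rwa [dist_add_left]⟩
  have hsep : ∀ i j, ∀ l ∈ L, dist (p i) (l + p j) < δ → i = j := by
    intro i j l hl h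
    have h1 : d (p i) ≤ d (p j) + dist (p i) (l + p j) :=
      (Metric.infDist_le_infDist_add_dist (y := l + p j)).trans (add_le_add_left (hdadd _ _ hl) _)
    have h2 : d (p j) ≤ d (p i) + dist (p i) (l + p j) := by
      have h3 := hdadd (l + p j) (-l) (L.neg_mem hl)
      rw [neg_add_cancel_left] at h3
      refine h3.trans ((Metric.infDist_le_infDist_add_dist (y := p i)).trans ?_)
      rw [dist_comm]
    rw [hp, hp] at h1 h2
    have h3 : (i : ℝ) < j + 1 := by nlinarith
    have h4 : (j : ℝ) < i + 1 := by nlinarith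
    have h5 : (i : ℕ) < j + 1 := by exact_mod_cast h3
    have h6 : (j : ℕ) < i + 1 := by exact_mod_cast h4
    exact Fin.ext (by omega)
  set S : Set (ι → ℝ) := ⋃ k, Metric.ball (p k) (δ / 2) with hS
  have hdisj : ∀ x ∈ S, ∀ y ∈ S, ∀ l ∈ L, x = l + y → l = 0 := by
    intro x hx y hy l hl hxy
    obtain ⟨i, hi⟩ := Set.mem_iUnion.mp hx
    obtain ⟨j, hj⟩ := Set.mem_iUnion.mp hy
    have h : dist (p i) (l + p j) < δ := by
      calc dist (p i) (l + p j) ≤ dist (p i) x + dist x (l + p j) := dist_triangle _ _ _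
        _ < δ / 2 + δ / 2 := by
          refine add_lt_add ?_ ?_
          · rw [dist_comm]; exact hi
          · rw [hxy, dist_add_left]; exact hj
        _ = δ := by ring
    obtain rfl := hsep i j l hl h
    by_contra hl0
    rw [dist_comm, dist_add_self_left] at h
    exact absurd (hL l hl hl0) (not_le.mpr h)
  have hvol : volume S = ENNReal.ofReal ((m + 1) * δ ^ Fintype.card ι) := by
    rw [hS, measure_iUnion _ (fun _ ↦ measurableSet_ball)]
    · simp_rw [Real.volume_pi_ball _ (half_pos hδ), mul_div_cancel₀ δ (two_ne_zero' ℝ)]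
      rw [tsum_fintype, Finset.sum_const, Finset.card_univ, Fintype.card_fin, nsmul_eq_mul,
        ENNReal.ofReal_mul (by positivity)]
      congr 1
      rw [← ENNReal.ofReal_natCast]
      push_cast
      rfl
    · intro i j hij
      refine Metric.ball_disjoint_ball ?_
      by_contra! h
      refine hij (hsep i j 0 L.zero_mem ?_)
      rw [zero_add]
      linarith
  let b := Module.Free.chooseBasis ℤ L
  have hF := ZLattice.isAddFundamentalDomain b volume
  by_contra! hlt
  have hFS : volume (ZSpan.fundamentalDomain (b.ofZLatticeBasis ℝ L)) < volume S := by
    rw [hvol]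
    rw [ZLattice.covolume_eq_measure_fundamentalDomain L volume hF] at hlt
    exact (ENNReal.lt_ofReal_iff_toReal_lt
      (ZSpan.fundamentalDomain_isBounded _).measure_lt_top.ne).mpr hlt
  have : Countable L.toAddSubgroup := by
    change Countable L
    infer_instance
  have : MeasurableVAdd L (ι → ℝ) := (inferInstance : MeasurableVAdd L.toAddSubgroup (ι → ℝ))
  have : VAddInvariantMeasure L (ι → ℝ) volume :=
    (inferInstance : VAddInvariantMeasure L.toAddSubgroup (ι → ℝ) volume)
  obtain ⟨x, y, hxy, hn⟩ := exists_pair_mem_lattice_not_disjoint_vadd (L := L) hF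
    (MeasurableSet.iUnion fun _ ↦ measurableSet_ball).nullMeasurableSet hFS
  obtain ⟨z, ⟨s, hs, hs'⟩, ⟨t, ht, ht'⟩⟩ := Set.not_disjoint_iff.mp hn
  have hst : (x : ι → ℝ) + s = y + t := hs'.trans ht'.symm
  have h0 := hdisj s hs t ht (y - x : L) (y - x : L).2 (by
    push_cast
    rw [sub_add_eq_add_sub, ← hst]; abel)
  exact hxy (sub_eq_zero.mp (Subtype.ext h0)).symm

/-- A bound on the covering radius of a lattice in terms of its covolume and its minimum. -/
theorem ZLattice.exists_norm_sub_mul_le {ι : Type*} [Fintype ι]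
    (L : Submodule ℤ (ι → ℝ)) [DiscreteTopology L] [IsZLattice ℝ L] {δ : ℝ} (hδ : 0 < δ)
    (hL : ∀ l ∈ L, l ≠ 0 → δ ≤ ‖l‖) (v : ι → ℝ) :
    ∃ l ∈ L, ‖v - l‖ * δ ^ Fintype.card ι ≤ ZLattice.covolume L * δ := by
  set m := ⌊Metric.infDist v (L : Set (ι → ℝ)) / δ⌋₊
  have hm : m * δ ≤ Metric.infDist v (L : Set (ι → ℝ)) :=
    (le_div_iff₀ hδ).mp (Nat.floor_le (div_nonneg Metric.infDist_nonneg hδ.le))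
  have hm' : Metric.infDist v (L : Set (ι → ℝ)) < (m + 1) * δ :=
    (div_lt_iff₀ hδ).mp (Nat.lt_floor_add_one _)
  obtain ⟨l, hl, hvl⟩ := (Metric.infDist_lt_iff ⟨0, L.zero_mem⟩).mp hm'
  refine ⟨l, hl, ?_⟩
  rw [dist_eq_norm] at hvl
  calc ‖v - l‖ * δ ^ Fintype.card ι ≤ (m + 1) * δ * δ ^ Fintype.card ι := by gcongr
    _ = (m + 1) * δ ^ Fintype.card ι * δ := by ring
    _ ≤ _ := by gcongr; exact ZLattice.pow_card_mul_le_covolume L hδ hL v m hm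

theorem TotPos.mul_sq {K : Type*} [Field K] {a : K} (ha : TotPos a) {q : ℚ} (hq : 0 < q)
    (v : (𝓞 K)ˣ) :
    TotPos (q * a * ((v : 𝓞 K) : K) ^ 2) := by
  intro φ
  have hv : φ (v : 𝓞 K) ≠ 0 := by simp
  rw [map_mul, map_mul, map_pow, map_ratCast]
  have := ha φ
  have : (0 : ℝ) < q := by exact_mod_cast hq
  positivity

section
open NumberField.InfinitePlace NumberField.Units NumberField.Units.dirichletUnitTheorem

variable {K : Type*} [Field K] [NumberField K]

open scoped Classical in
theorem NumberField.Units.one_third_le_norm_logEmbedding_of_le_one (htr : TotallyReal K)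
    (u : (𝓞 K)ˣ) (hu : logEmbedding K (Additive.ofMul u) ≠ 0) (h0 : (w₀ : InfinitePlace K) u ≤ 1) :
    1 / 3 ≤ ‖logEmbedding K (Additive.ofMul u)‖ := by
  by_contra! hlt
  have hw : ∀ w : InfinitePlace K, w u ^ 2 < 2 := by
    intro w
    have hpos : 0 < w u := Units.pos_at_place u w
    by_cases h : w = w₀
    · subst h; nlinarith
    have h1 : |Real.log (w u)| < 1 / 3 := by
      have := (norm_le_pi_norm (logEmbedding K (Additive.ofMul u)) ⟨w, h⟩).trans_lt hlt
      rwa [logEmbedding_component, (htr w).mult_eq_one, Nat.cast_one, one_mul,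
        Real.norm_eq_abs] at this
    have h2 : Real.log (w u ^ 2) < Real.log 2 := by
      rw [Real.log_pow]
      push_cast
      linarith [(abs_lt.mp h1).2, Real.log_two_gt_d9]
    exact (Real.log_lt_log_iff (by positivity) two_pos).mp h2
  have hz : ((u : 𝓞 K) ^ 2 - 1 : 𝓞 K) = 0 := by
    by_contra hne
    have key : ∀ w : InfinitePlace K, w (((u : 𝓞 K) ^ 2 - 1 : 𝓞 K) : K) < 1 := by
      intro w
      have hpos : 0 < w u := Units.pos_at_place u w
      have h2 := hw w
      rw [← norm_embedding_of_isReal (htr w)] at h2 hpos ⊢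
      rw [Real.norm_eq_abs, abs_pos] at hpos
      rw [Real.norm_eq_abs, sq_abs] at h2
      have := sq_pos_of_ne_zero hpos
      simp only [map_sub, map_pow, map_one, Real.norm_eq_abs]
      rw [abs_lt]
      constructor <;> linarith
    exact absurd (one_le_of_lt_one (w := w₀) hne fun w _ ↦ key w) (not_le.mpr (key w₀))
  apply hu
  rw [logEmbedding_eq_zero_iff]
  rw [torsion, CommGroup.mem_torsion]
  rw [isOfFinOrder_iff_pow_eq_one]
  exact ⟨2, two_pos, Units.ext (by simpa using sub_eq_zero.mp hz)⟩

open scoped Classical in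
theorem NumberField.Units.one_third_le_norm_of_mem_unitLattice (htr : TotallyReal K)
    (l : logSpace K) (hl : l ∈ unitLattice K) (hl0 : l ≠ 0) : 1 / 3 ≤ ‖l‖ := by
  obtain ⟨u, -, rfl⟩ := hl
  change logEmbedding K (Additive.ofMul u.toMul) ≠ 0 at hl0
  change 1 / 3 ≤ ‖logEmbedding K (Additive.ofMul u.toMul)‖
  rcases le_total ((w₀ : InfinitePlace K) u.toMul) 1 with h | h
  · exact one_third_le_norm_logEmbedding_of_le_one htr _ hl0 h
  · rw [← norm_neg, ← map_neg, ← ofMul_inv]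
    refine one_third_le_norm_logEmbedding_of_le_one htr _ ?_ ?_
    · rwa [ofMul_inv, map_neg, neg_ne_zero]
    · rw [map_units_inv, map_inv₀]
      exact inv_le_one_of_one_le₀ h

/-- The embedding of a totally real field at an infinite place. -/
noncomputable abbrev TotallyReal.emb (htr : TotallyReal K) (w : InfinitePlace K) : K →+* ℝ :=
  embedding_of_isReal (htr w)

theorem TotallyReal.emb_sq (htr : TotallyReal K) (w : InfinitePlace K) (x : K) :
    htr.emb w x ^ 2 = w x ^ 2 := by
  rw [← norm_embedding_of_isReal (htr w), Real.norm_eq_abs, sq_abs]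

theorem TotallyReal.finrank_eq_card (htr : TotallyReal K) :
    Module.finrank ℚ K = Fintype.card (InfinitePlace K) := by
  rw [← sum_mult_eq]
  simp [(htr _).mult_eq_one]

theorem TotallyReal.trace_eq_sum (htr : TotallyReal K) (x : K) :
    ((Algebra.trace ℚ K x : ℚ) : ℝ) = ∑ w, htr.emb w x := by
  have hC := trace_eq_sum_embeddings (K := ℚ) (L := K) ℂ (x := x)
  have hsum : ∑ σ : K →ₐ[ℚ] ℂ, σ x = ∑ w : InfinitePlace K, w.embedding x := by
    symm
    refine Fintype.sum_bijective (fun w : InfinitePlace K ↦ RingHom.equivRatAlgHom K ℂ w.embedding)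
      ?_ _ _ fun w ↦ rfl
    rw [← Function.comp_def, EquivLike.comp_bijective]
    refine ⟨fun w w' h ↦ by rw [← mk_embedding w, h, mk_embedding], fun φ ↦ ⟨mk φ, ?_⟩⟩
    exact embedding_mk_eq_of_isReal (isReal_mk_iff.mp (htr _))
  rw [hsum] at hC
  apply Complex.ofReal_injective
  push_cast
  simp only [embedding_of_isReal_apply]
  simpa using hC

theorem TotallyReal.trForm_eq_sum (htr : TotallyReal K) (a : K) (x : 𝓞 K) :
    (trForm a x : ℝ) = ∑ w, htr.emb w a * w x ^ 2 := by
  rw [trForm, htr.trace_eq_sum]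
  simp only [map_mul, map_pow, htr.emb_sq]

theorem TotallyReal.muMin_le (htr : TotallyReal K) {a : K} (ha : TotPos a) {x : 𝓞 K} (hx : x ≠ 0) :
    muMin a ≤ trForm a x := by
  refine csInf_le ⟨0, ?_⟩ ⟨x, hx, rfl⟩
  rintro _ ⟨y, -, rfl⟩
  rw [htr.trForm_eq_sum]
  exact Finset.sum_nonneg fun w _ ↦ mul_nonneg (ha _).le (sq_nonneg _)

/-- Minkowski's theorem for a cube. -/
theorem TotallyReal.exists_ne_zero_forall_lt (htr : TotallyReal K) {F : ℝ} (hF : 0 < F)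
    (h : √|(discr K : ℝ)| < F ^ Module.finrank ℚ K) :
    ∃ z : 𝓞 K, z ≠ 0 ∧ ∀ w : InfinitePlace K, w z < F := by
  classical
  have hc : nrComplexPlaces K = 0 := by
    rw [nrComplexPlaces, Fintype.card_eq_zero_iff]
    exact ⟨fun w ↦ not_isReal_iff_isComplex.mpr w.2 (htr w.1)⟩
  have hr : nrRealPlaces K = Module.finrank ℚ K := by
    rw [← card_add_two_mul_card_eq_rank K, hc]; rfl
  lift F to NNReal using hF.le
  refine mixedEmbedding.exists_ne_zero_mem_ringOfIntegers_lt K (f := fun _ ↦ F) ?_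
  rw [mixedEmbedding.convexBodyLT_volume, mixedEmbedding.minkowskiBound,
    mixedEmbedding.volume_fundamentalDomain_fractionalIdealLatticeBasis,
    mixedEmbedding.volume_fundamentalDomain_latticeBasis, mixedEmbedding.finrank]
  simp only [(htr _).mult_eq_one, hc, hr, mixedEmbedding.convexBodyLTFactor]
  have hD : NNReal.sqrt ‖discr K‖₊ < F ^ Module.finrank ℚ K := by
    rw [← NNReal.coe_lt_coe]
    push_cast
    rwa [Int.norm_eq_abs]
  rw [Units.val_one, FractionalIdeal.absNorm_one]
  simp only [Rat.cast_one, ENNReal.ofReal_one, pow_zero, one_mul, mul_one, pow_one,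
    Finset.prod_const, Finset.card_univ, ← htr.finrank_eq_card]
  rw [mul_comm]
  norm_cast
  gcongr

open scoped Classical in
theorem NumberField.Units.exists_norm_sub_logEmbedding_le (htr : TotallyReal K)
    (hn : 2 ≤ Module.finrank ℚ K) (v : logSpace K) :
    ∃ u : (𝓞 K)ˣ, ‖v - logEmbedding K (Additive.ofMul u)‖ ≤
      regulator K * 3 ^ (Module.finrank ℚ K - 2) := by
  have hcard : Fintype.card {w : InfinitePlace K // w ≠ w₀} = (Module.finrank ℚ K - 2) + 1 := by
    rw [htr.finrank_eq_card] at *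
    simp only [Fintype.card_subtype_compl, Fintype.card_subtype_eq]
    omega
  obtain ⟨l, ⟨u, -, rfl⟩, h⟩ := ZLattice.exists_norm_sub_mul_le (unitLattice K) (δ := 1 / 3)
    (by norm_num) (one_third_le_norm_of_mem_unitLattice htr) v
  refine ⟨u.toMul, ?_⟩
  change ‖v - logEmbedding K (Additive.ofMul u.toMul)‖ * _ ≤ regulator K * _ at h
  rw [hcard, pow_succ, one_div_pow, ← mul_assoc] at h
  have h' := le_of_mul_le_mul_right h (by norm_num)
  rwa [mul_one_div, div_le_iff₀ (by positivity)] at h'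

open scoped Classical in
theorem NumberField.Units.one_le_regulator_mul (htr : TotallyReal K) :
    1 ≤ regulator K * 3 ^ (Module.finrank ℚ K - 1) := by
  have hcard : Fintype.card {w : InfinitePlace K // w ≠ w₀} = Module.finrank ℚ K - 1 := by
    simp only [htr.finrank_eq_card, Fintype.card_subtype_compl, Fintype.card_subtype_eq]
  have h := ZLattice.pow_card_mul_le_covolume (unitLattice K) (δ := 1 / 3)
    (by norm_num) (one_third_le_norm_of_mem_unitLattice htr) 0 0
    (by simpa using Metric.infDist_nonneg)
  change _ ≤ regulator K at h
  rw [hcard, Nat.cast_zero, zero_add, one_mul, one_div_pow, div_le_iff₀ (by positivity)] at h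
  exact h

/-- Multiplying by the square of a suitable unit makes all conjugates of a totally positive element
comparable. -/
theorem TotallyReal.exists_unit_balanced (htr : TotallyReal K) (hn : 2 ≤ Module.finrank ℚ K)
    {a : K} (ha : TotPos a) :
    ∃ u : (𝓞 K)ˣ, ∃ m : ℝ, ∀ w : InfinitePlace K,
      |Real.log (htr.emb w a * w u ^ 2) - m| ≤
        2 * Module.finrank ℚ K * (regulator K * 3 ^ (Module.finrank ℚ K - 2)) := by
  classical
  set n := Module.finrank ℚ K with hndef
  have hn0 : (2 : ℝ) ≤ n := by exact_mod_cast hn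
  set τ := regulator K * 3 ^ (n - 2) with hτ
  have hτ0 : 0 ≤ τ := by have := regulator_pos K; positivity
  set m : ℝ := (∑ w, Real.log (htr.emb w a)) / n with hm
  obtain ⟨u, hu⟩ := exists_norm_sub_logEmbedding_le htr hn
    (fun w : {w : InfinitePlace K // w ≠ w₀} ↦ (m - Real.log (htr.emb w.1 a)) / 2)
  refine ⟨u, m, ?_⟩
  have hlog : ∀ w : InfinitePlace K, Real.log (htr.emb w a * w u ^ 2) =
      Real.log (htr.emb w a) + 2 * Real.log (w u) := by
    intro w
    rw [Real.log_mul (ha _).ne' (pow_ne_zero _ (Units.pos_at_place u w).ne'), Real.log_pow]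
    push_cast; rfl
  have h1 : ∀ w : InfinitePlace K, w ≠ w₀ → |Real.log (htr.emb w a * w u ^ 2) - m| ≤ 2 * τ := by
    intro w hw
    have := (norm_le_pi_norm _ ⟨w, hw⟩).trans hu
    rw [Pi.sub_apply, logEmbedding_component, (htr w).mult_eq_one, Nat.cast_one, one_mul,
      Real.norm_eq_abs, abs_le] at this
    rw [hlog, abs_le]
    constructor <;> linarith
  have hsum : ∑ w : InfinitePlace K, (Real.log (htr.emb w a * w u ^ 2) - m) = 0 := by
    have := sum_mult_mul_log u
    simp only [(htr _).mult_eq_one, Nat.cast_one, one_mul] at this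
    simp_rw [hlog]
    rw [Finset.sum_sub_distrib, Finset.sum_add_distrib, ← Finset.mul_sum, this, Finset.sum_const,
      Finset.card_univ, ← htr.finrank_eq_card, nsmul_eq_mul, ← hndef, hm,
      mul_div_cancel₀ _ (by positivity)]
    ring
  intro w
  by_cases hw : w = w₀
  · subst hw
    rw [← Finset.add_sum_erase _ _ (Finset.mem_univ w₀), add_eq_zero_iff_eq_neg] at hsum
    rw [hsum, abs_neg]
    refine (Finset.abs_sum_le_sum_abs _ _).trans ((Finset.sum_le_card_nsmul _ _ (2 * τ) fun w hw ↦
      h1 w (Finset.ne_of_mem_erase hw)).trans ?_)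
    rw [Finset.card_erase_of_mem (Finset.mem_univ _), Finset.card_univ, ← htr.finrank_eq_card,
      nsmul_eq_mul, ← hndef]
    have : ((n - 1 : ℕ) : ℝ) ≤ n := by exact_mod_cast Nat.sub_le n 1
    nlinarith
  · refine (h1 w hw).trans ?_
    nlinarith

/-- Up to a unit, minimal vectors of a totally positive element are bounded. -/
theorem TotallyReal.exists_unit_minVecs_bounded (htr : TotallyReal K)
    (hn : 2 ≤ Module.finrank ℚ K) {a : K} (ha : TotPos a) {F : ℝ} (hF : 0 < F)
    (h : √|(discr K : ℝ)| < F ^ Module.finrank ℚ K) :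
    ∃ u : (𝓞 K)ˣ, ∀ x ∈ MinVecs a, ∀ w : InfinitePlace K,
      w ((↑u⁻¹ * x : 𝓞 K) : K) ^ 2 ≤ Module.finrank ℚ K * Real.exp
        (4 * Module.finrank ℚ K * (regulator K * 3 ^ (Module.finrank ℚ K - 2))) * F ^ 2 := by
  obtain ⟨u, m, hu⟩ := htr.exists_unit_balanced hn ha
  set n := Module.finrank ℚ K with hndef
  set T := 2 * n * (regulator K * 3 ^ (n - 2)) with hT
  have hpos : ∀ w : InfinitePlace K, 0 < htr.emb w a * w u ^ 2 := fun w ↦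
    mul_pos (ha _) (pow_pos (Units.pos_at_place u w) 2)
  have hup : ∀ w : InfinitePlace K, htr.emb w a * w u ^ 2 ≤ Real.exp (m + T) := fun w ↦ by
    rw [← Real.log_le_iff_le_exp (hpos w)]
    linarith [(abs_le.mp (hu w)).2]
  have hlo : ∀ w : InfinitePlace K, Real.exp (m - T) ≤ htr.emb w a * w u ^ 2 := fun w ↦ by
    rw [← Real.le_log_iff_exp_le (hpos w)]
    linarith [(abs_le.mp (hu w)).1]
  obtain ⟨z, hz, hzF⟩ := htr.exists_ne_zero_forall_lt hF h
  have hmu : muMin a ≤ n * (Real.exp (m + T) * F ^ 2) := by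
    refine (htr.muMin_le ha (x := u * z) (mul_ne_zero u.ne_zero hz)).trans ?_
    rw [htr.trForm_eq_sum, hndef, htr.finrank_eq_card, ← Finset.card_univ, ← nsmul_eq_mul]
    refine Finset.sum_le_card_nsmul _ _ _ fun w _ ↦ ?_
    rw [show ((u * z : 𝓞 K) : K) = (u : 𝓞 K) * z from map_mul (algebraMap (𝓞 K) K) _ _, map_mul,
      mul_pow, ← mul_assoc]
    have := hzF w
    have h0 : 0 ≤ w (z : K) := apply_nonneg _ _
    gcongr
    exact hup w
  refine ⟨u, fun x hx w ↦ ?_⟩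
  have hx1 : Real.exp (m - T) * w ((↑u⁻¹ * x : 𝓞 K) : K) ^ 2 ≤ n * (Real.exp (m + T) * F ^ 2) := by
    calc _ ≤ htr.emb w a * w u ^ 2 * w ((↑u⁻¹ * x : 𝓞 K) : K) ^ 2 := by gcongr; exact hlo w
      _ = htr.emb w a * w x ^ 2 := by
        rw [mul_assoc, ← mul_pow, ← map_mul, ← map_mul, Units.mul_inv_cancel_left]
      _ ≤ trForm a x := by
        rw [htr.trForm_eq_sum]
        exact Finset.single_le_sum (f := fun w ↦ htr.emb w a * w x ^ 2)
          (fun w _ ↦ mul_nonneg (ha _).le (sq_nonneg _)) (Finset.mem_univ w)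
      _ = muMin a := hx
      _ ≤ _ := hmu
  have hexp : Real.exp (m + T) = Real.exp (m - T) * Real.exp (4 * n * (regulator K * 3 ^ (n - 2))) := by
    rw [← Real.exp_add]; congr 1; rw [hT]; ring
  rw [hexp] at hx1
  refine le_of_mul_le_mul_left (hx1.trans (le_of_eq ?_)) (Real.exp_pos (m - T))
  ring

theorem trForm_mul_unit_sq (a : K) (v : (𝓞 K)ˣ) (q : ℚ) (x : 𝓞 K) :
    trForm (q * a * ((v : 𝓞 K) : K) ^ 2) x = q * trForm a (v * x) := by
  rw [trForm, trForm, ← smul_eq_mul q, ← map_smul]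
  congr 1
  rw [show ((v * x : 𝓞 K) : K) = (v : 𝓞 K) * x from map_mul (algebraMap (𝓞 K) K) _ _,
    Algebra.smul_def, eq_ratCast]
  ring

/-- The minimum of a perfect form is a positive rational number. -/
theorem IsPerfectForm.exists_muMin_eq (htr : TotallyReal K) {a : K} (ha : IsPerfectForm a) :
    ∃ q : ℚ, 0 < q ∧ muMin a = q := by
  have ha0 : a ≠ 0 := by
    rintro rfl
    have := ha.1 (htr.emb (Classical.arbitrary _))
    simp at this
  have h2 : TotPos (2 * a) := fun φ ↦ by
    rw [map_mul, map_ofNat]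
    exact mul_pos two_pos (ha.1 φ)
  have h2a : 2 * a ≠ a := by
    intro h
    rw [two_mul, add_eq_left] at h
    exact ha0 h
  have hne := mt (ha.2 (2 * a) h2) h2a
  push Not at hne
  obtain ⟨x, hx, hne⟩ := hne
  have h2x : trForm (2 * a) x = 2 * trForm a x := by
    simpa using trForm_mul_unit_sq a 1 2 x
  rw [h2x] at hne
  have hx' : (trForm a x : ℝ) = muMin a := hx
  have h0 : (0 : ℝ) ≤ trForm a x := by
    rw [htr.trForm_eq_sum]
    exact Finset.sum_nonneg fun w _ ↦ mul_nonneg (ha.1 _).le (sq_nonneg _)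
  refine ⟨trForm a x, lt_of_le_of_ne (by exact_mod_cast h0) fun h ↦ hne ?_, hx'.symm⟩
  rw [← hx', ← h]
  norm_num

/-- Finitely many minimal vectors, at most the degree, carry all linear information. -/
theorem exists_finset_minVecs (a : K) :
    ∃ S : Finset (𝓞 K), (∀ x ∈ S, x ∈ MinVecs a) ∧ S.card ≤ Module.finrank ℚ K ∧
      ∀ b : K, (∀ x ∈ S, (trForm b x : ℝ) = muMin a) →
        ∀ x ∈ MinVecs a, (trForm b x : ℝ) = muMin a := by
  classical
  obtain ⟨t, hts, hspan, hli⟩ :=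
    exists_linearIndependent ℚ ((fun x : 𝓞 K ↦ (x : K) ^ 2) '' MinVecs a)
  have hfin : t.Finite := hli.setFinite
  have hts_mem : ∀ y ∈ t, ∃ x, x ∈ MinVecs a ∧ (x : K) ^ 2 = y := fun y hy ↦ hts hy
  choose! f hf using hts_mem
  refine ⟨hfin.toFinset.image f, ?_, ?_, ?_⟩
  · intro x hx
    obtain ⟨y, hy, rfl⟩ := Finset.mem_image.mp hx
    exact (hf _ (hfin.mem_toFinset.mp hy)).1
  · refine Finset.card_image_le.trans ?_
    have := hfin.fintype
    have h := hli.fintype_card_le_finrank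
    rwa [← Set.toFinset_card, Set.Finite.toFinset_eq_toFinset hfin] at *
  · intro b hb x hx
    have hsub : t ⊆ LinearMap.ker ((Algebra.trace ℚ K).comp (LinearMap.mulLeft ℚ (b - a))) := by
      intro y hy
      have h1 := hb _ (Finset.mem_image_of_mem f (hfin.mem_toFinset.mpr hy))
      have h2 : (trForm a (f y) : ℝ) = muMin a := (hf _ hy).1
      have h3 : trForm b (f y) = trForm a (f y) := by exact_mod_cast h1.trans h2.symm
      have h4 : ((f y : 𝓞 K) : K) ^ 2 = y := (hf _ hy).2
      rw [trForm, trForm, h4] at h3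
      simp [sub_mul, h3]
    have hx2 := Submodule.span_le.mpr hsub
      (hspan ▸ Submodule.subset_span (Set.mem_image_of_mem (fun x : 𝓞 K ↦ (x : K) ^ 2) hx))
    simp only [LinearMap.mem_ker, LinearMap.comp_apply, LinearMap.mulLeft_apply, sub_mul, map_sub]
      at hx2
    rw [show trForm b x = trForm a x from sub_eq_zero.mp hx2]
    exact hx

/-- The trace of `a u²` against a sum of squares of the vectors `u⁻¹ x`. -/
theorem sum_trForm_eq {a : K} {u u' : (𝓞 K)ˣ} {S S' : Finset (𝓞 K)}
    (h : ∑ x ∈ S, (↑u⁻¹ * x) ^ 2 = ∑ x ∈ S', (↑u'⁻¹ * x) ^ 2) :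
    ∑ x ∈ S, trForm a x = ∑ x ∈ S', trForm a (↑(u * u'⁻¹) * x) := by
  have key : ∀ (v : (𝓞 K)ˣ) (R : Finset (𝓞 K)), ∑ x ∈ R, trForm a (↑(u * v⁻¹) * x) =
      Algebra.trace ℚ K (a * ((u : 𝓞 K) : K) ^ 2 * ((∑ x ∈ R, (↑v⁻¹ * x) ^ 2 : 𝓞 K) : K)) := by
    intro v R
    simp only [trForm, map_sum, map_pow, map_mul, Finset.mul_sum, Units.val_mul]
    refine Finset.sum_congr rfl fun x _ ↦ ?_
    congr 1
    ring
  rw [key u' S', ← h, ← key u S]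
  simp

theorem card_le_card_of_sum_eq (htr : TotallyReal K) {a : K} (ha : IsPerfectForm a)
    {u u' : (𝓞 K)ˣ} {S S' : Finset (𝓞 K)} (hS : ∀ x ∈ S, x ∈ MinVecs a) (hS' : ∀ x ∈ S', x ≠ 0)
    (h : ∑ x ∈ S, (↑u⁻¹ * x) ^ 2 = ∑ x ∈ S', (↑u'⁻¹ * x) ^ 2) :
    S'.card ≤ S.card ∧ (S.card ≤ S'.card →
      ∀ x ∈ S', (trForm a (↑(u * u'⁻¹) * x) : ℝ) = muMin a) := by
  obtain ⟨q, hq, hmu⟩ := ha.exists_muMin_eq htr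
  have hq' : 0 < muMin a := by rw [hmu]; exact_mod_cast hq
  have hsum := congrArg (Rat.cast : ℚ → ℝ) (sum_trForm_eq (a := a) h)
  push_cast at hsum
  rw [Finset.sum_congr rfl fun x hx ↦ show (trForm a x : ℝ) = muMin a from hS x hx,
    Finset.sum_const, nsmul_eq_mul] at hsum
  have hle : ∀ x ∈ S', muMin a ≤ (trForm a (↑(u * u'⁻¹) * x) : ℝ) := fun x hx ↦
    htr.muMin_le ha.1 (mul_ne_zero (Units.ne_zero _) (hS' x hx))
  have hge := Finset.card_nsmul_le_sum S' _ _ hle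
  rw [nsmul_eq_mul] at hge
  refine ⟨by exact_mod_cast le_of_mul_le_mul_right (hge.trans_eq hsum.symm) hq', fun hc x hx ↦ ?_⟩
  have heq : ∑ x ∈ S', muMin a = ∑ x ∈ S', (trForm a (↑(u * u'⁻¹) * x) : ℝ) := by
    refine le_antisymm (Finset.sum_le_sum hle) ?_
    push_cast
    rw [← hsum, Finset.sum_const, nsmul_eq_mul]
    have : (S.card : ℝ) ≤ S'.card := by exact_mod_cast hc
    gcongr
  exact ((Finset.sum_eq_sum_iff_of_le hle).mp heq x hx).symm

theorem IsPerfectForm.ne_zero_of_mem_minVecs (htr : TotallyReal K) {a : K} (ha : IsPerfectForm a)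
    {x : 𝓞 K} (hx : x ∈ MinVecs a) : x ≠ 0 := by
  rintro rfl
  obtain ⟨q, hq, hmu⟩ := ha.exists_muMin_eq htr
  have h0 : (trForm a 0 : ℝ) = muMin a := hx
  rw [hmu] at h0
  have h1 : trForm a 0 = q := by exact_mod_cast h0
  simp [trForm] at h1
  exact hq.ne h1

/-- The sum of squares of spanning minimal vectors, moved by a unit, determines the class. -/
theorem homothetic_of_sum_sq_eq (htr : TotallyReal K) {a a' : K} (ha : IsPerfectForm a)
    (ha' : IsPerfectForm a') {u u' : (𝓞 K)ˣ} {S S' : Finset (𝓞 K)}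
    (hS : ∀ x ∈ S, x ∈ MinVecs a) (hS' : ∀ x ∈ S', x ∈ MinVecs a')
    (hspan : ∀ b : K, (∀ x ∈ S', (trForm b x : ℝ) = muMin a') →
      ∀ x ∈ MinVecs a', (trForm b x : ℝ) = muMin a')
    (h : ∑ x ∈ S, (↑u⁻¹ * x) ^ 2 = ∑ x ∈ S', (↑u'⁻¹ * x) ^ 2) : Homothetic a a' := by
  obtain ⟨q, hq, hmu⟩ := ha.exists_muMin_eq htr
  obtain ⟨q', hq', hmu'⟩ := ha'.exists_muMin_eq htr
  have h1 := card_le_card_of_sum_eq htr ha hS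
    (fun x hx ↦ ha'.ne_zero_of_mem_minVecs htr (hS' x hx)) h
  have h2 := card_le_card_of_sum_eq htr ha' hS'
    (fun x hx ↦ ha.ne_zero_of_mem_minVecs htr (hS x hx)) h.symm
  refine ⟨q' / q, div_pos hq' hq, u * u'⁻¹, ?_⟩
  refine (ha'.2 _ (ha.1.mul_sq (div_pos hq' hq) _) (hspan _ fun x hx ↦ ?_)).symm
  have hx' := h1.2 h2.1 x hx
  rw [trForm_mul_unit_sq, Rat.cast_mul, hx', hmu, hmu']
  have : (q : ℝ) ≠ 0 := by exact_mod_cast hq.ne'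
  push_cast
  field_simp

/-- A bound for the number of classes in terms of the regulator and any radius for which
Minkowski's theorem applies to a cube. -/
theorem TotallyReal.numClasses_le (htr : TotallyReal K) (hn : 2 ≤ Module.finrank ℚ K)
    {F : ℝ} (hF : 0 < F) (h : √|(discr K : ℝ)| < F ^ Module.finrank ℚ K) :
    (numClasses K : ℝ) ≤ (Module.finrank ℚ K * (Module.finrank ℚ K * Real.exp
      (4 * Module.finrank ℚ K * (regulator K * 3 ^ (Module.finrank ℚ K - 2))) * F ^ 2) + 1) ^
        Module.finrank ℚ K := by
  set n := Module.finrank ℚ K with hndef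
  set B : ℝ := n * Real.exp (4 * n * (regulator K * 3 ^ (n - 2))) * F ^ 2 with hB
  have hB0 : 0 ≤ B := by positivity
  choose! u hu using fun (a : K) (ha : TotPos a) ↦ htr.exists_unit_minVecs_bounded hn ha hF h
  choose S hS hScard hSspan using exists_finset_minVecs (K := K)
  let y : K → 𝓞 K := fun a ↦ ∑ x ∈ S a, (↑(u a)⁻¹ * x) ^ 2
  have hy : ∀ a (w : InfinitePlace K),
      htr.emb w (y a) = ∑ x ∈ S a, w ((↑(u a)⁻¹ * x : 𝓞 K) : K) ^ 2 := by
    intro a w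
    simp only [y, map_sum, map_pow, htr.emb_sq]
  have hy0 : ∀ a (w : InfinitePlace K), 0 ≤ htr.emb w (y a) := fun a w ↦ by
    rw [hy]; positivity
  have hyB : ∀ a, TotPos a → ∀ w : InfinitePlace K, htr.emb w (y a) ≤ n * B := by
    intro a ha w
    rw [hy]
    refine (Finset.sum_le_card_nsmul _ _ B fun x hx ↦ hu a ha x (hS a x hx) w).trans ?_
    rw [nsmul_eq_mul]
    have : ((S a).card : ℝ) ≤ n := by exact_mod_cast hScard a
    gcongr
  let f : {a : K // IsPerfectForm a} → InfinitePlace K → Fin (⌊n * B⌋₊ + 1) := fun a w ↦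
    ⟨⌊htr.emb w (y a)⌋₊, Nat.lt_succ_of_le (Nat.floor_le_floor (hyB a a.2.1 w))⟩
  have hf : ∀ a b, f a = f b → Homothetic (a : K) b := by
    intro a b hab
    refine homothetic_of_sum_sq_eq (u := u a) (u' := u b) htr a.2 b.2 (hS a) (hS b) (hSspan b) ?_
    change y a = y b
    by_contra hne
    have key : ∀ w : InfinitePlace K, w ((y a - y b : 𝓞 K) : K) < 1 := by
      intro w
      have hw : ⌊htr.emb w (y a)⌋₊ = ⌊htr.emb w (y b)⌋₊ := congrArg Fin.val (congrFun hab w)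
      have h1 := Nat.floor_le (hy0 a w)
      have h2 := Nat.floor_le (hy0 b w)
      have h3 := Nat.lt_floor_add_one (htr.emb w (y a))
      have h4 := Nat.lt_floor_add_one (htr.emb w (y b))
      rw [hw] at h1 h3
      have e : ‖htr.emb w ((y a - y b : 𝓞 K) : K)‖ = w ((y a - y b : 𝓞 K) : K) :=
        norm_embedding_of_isReal (htr w) _
      rw [← e, show ((y a - y b : 𝓞 K) : K) = y a - y b from map_sub (algebraMap (𝓞 K) K) _ _,
        map_sub, Real.norm_eq_abs, abs_lt]
      constructor <;> linarith
    exact absurd (one_le_of_lt_one (w := w₀) (sub_ne_zero.mpr hne) fun w _ ↦ key w)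
      (not_le.mpr (key w₀))
  have hcard : numClasses K ≤ (⌊n * B⌋₊ + 1) ^ n := by
    refine (Nat.card_le_card_of_injective (fun c ↦ f c.out) fun c d hcd ↦ ?_).trans ?_
    · rw [← Quot.out_eq c, ← Quot.out_eq d]
      exact Quot.sound (hf _ _ hcd)
    · rw [Nat.card_fun, Nat.card_fin, Nat.card_eq_fintype_card, hndef, htr.finrank_eq_card]
  calc (numClasses K : ℝ) ≤ ((⌊n * B⌋₊ + 1 : ℕ) : ℝ) ^ n := by exact_mod_cast hcard
    _ ≤ _ := by
      push_cast
      gcongr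
      exact Nat.floor_le (by positivity)

end

theorem two_hundred_mul_sq_le_pow {n : ℕ} (hn : 12 ≤ n) : (200 : ℝ) * n ^ 2 ≤ 100 ^ (n - 2) := by
  obtain ⟨k, rfl⟩ := Nat.exists_eq_add_of_le hn
  rw [show 12 + k - 2 = 10 + k by omega]
  induction k with
  | zero => norm_num
  | succ k ih =>
    have := ih (by omega)
    rw [← add_assoc 10, pow_succ (100 : ℝ)]
    push_cast at this ⊢
    nlinarith [(Nat.cast_nonneg k : (0 : ℝ) ≤ k)]

theorem one_le_Gamma_two_add {x : ℝ} (hx : 0 ≤ x) : 1 ≤ Real.Gamma (2 + x) := by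
  have := Real.Gamma_strictMonoOn_Ici.monotoneOn (Set.mem_Ici.mpr le_rfl)
    (Set.mem_Ici.mpr (by linarith : (2 : ℝ) ≤ 2 + x)) (by linarith)
  rwa [Real.Gamma_two] at this

theorem half_le_two_div_pi : (1 / 2 : ℝ) ≤ 2 / π := by
  rw [div_le_div_iff₀ two_pos pi_pos]
  linarith [pi_le_four]

theorem thousand_pow_le {n : ℕ} (hn : 12 ≤ n) :
    (1000 : ℝ) ^ (n - 2) ≤ (Real.sqrt (2 / (n : ℝ)) * (1 / 1000) *
      (Real.log (Real.log (n : ℝ)) / Real.log (n : ℝ)) ^ 3) ^ ((2 : ℝ) - (n : ℝ)) := by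
  have hn' : (12 : ℝ) ≤ n := by exact_mod_cast hn
  have hl : 1 < Real.log n := by
    rw [Real.lt_log_iff_exp_lt (by linarith)]
    linarith [Real.exp_one_lt_d9]
  have hr0 : 0 < Real.log (Real.log n) / Real.log n := div_pos (Real.log_pos hl) (by linarith)
  have hr1 : Real.log (Real.log n) / Real.log n ≤ 1 := by
    rw [div_le_one (by linarith)]
    exact Real.log_le_self (by linarith)
  have hs0 : 0 < Real.sqrt (2 / (n : ℝ)) := Real.sqrt_pos.mpr (by positivity)
  have hs1 : Real.sqrt (2 / (n : ℝ)) ≤ 1 := by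
    rw [Real.sqrt_le_one, div_le_one (by linarith)]
    linarith
  set L := Real.sqrt (2 / (n : ℝ)) * (1 / 1000) *
      (Real.log (Real.log (n : ℝ)) / Real.log (n : ℝ)) ^ 3 with hL
  have hL0 : 0 < L := by positivity
  have hL1 : L ≤ 1 / 1000 := by
    calc L ≤ 1 * (1 / 1000) * 1 ^ 3 := by rw [hL]; gcongr
      _ = _ := by norm_num
  rw [show (2 : ℝ) - n = -((n - 2 : ℕ) : ℝ) by push_cast [show 2 ≤ n by omega]; ring,
    Real.rpow_neg hL0.le, Real.rpow_natCast, ← inv_pow]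
  gcongr
  rw [le_inv_comm₀ (by norm_num) hL0]
  linarith

/-- Unconditional bound on the number of homothety classes of perfect
unary forms for a totally real field of degree `n ≥ 12`. -/
theorem perfect_form_classes_bound_large_degree_unconditional
    (K : Type*) [Field K] [NumberField K] (n : ℕ)
    (hdeg : Module.finrank ℚ K = n) (hn : 12 ≤ n)
    (htr : TotallyReal K) :
    (numClasses K : ℝ) ≤
      Real.exp ((n : ℝ) * Real.sqrt
          ((Real.sqrt ((n : ℝ) - 1) / 2 * (2 / π) ^ (n - 1) *
              Real.Gamma (2 + ((n : ℝ) - 1) / 2) ^ 2 *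
              (Real.sqrt (2 / (n : ℝ)) * (1 / 1000) *
                  (Real.log (Real.log (n : ℝ)) / Real.log (n : ℝ)) ^ 3) ^
                ((2 : ℝ) - (n : ℝ)) *
              NumberField.Units.regulator K) ^ 2 +
            4 / ((n : ℝ) - 1) *
              Real.log ((n : ℝ) ^ (-(n : ℝ) / 2) *
                  Real.sqrt |(NumberField.discr K : ℝ)| * (2 / π) ^ ((n : ℝ) / 2) *
                  Real.Gamma (2 + (n : ℝ) / 2)) ^ 2)) *
        |(NumberField.discr K : ℝ)| * (2 / π) ^ (2 * n) *
        Real.Gamma (2 + (n : ℝ) / 2) ^ 4 := by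
  have hn' : (12 : ℝ) ≤ n := by exact_mod_cast hn
  have htwo : 2 ≤ Module.finrank ℚ K := by omega
  set R := NumberField.Units.regulator K with hR
  have hR0 : 0 < R := NumberField.Units.regulator_pos K
  have hR1 : 1 ≤ R * 3 ^ (n - 1) := by
    rw [← hdeg]; exact NumberField.Units.one_le_regulator_mul htr
  have hD1 : 1 ≤ |(NumberField.discr K : ℝ)| := by
    have := Int.one_le_abs (NumberField.discr_ne_zero K)
    exact_mod_cast this
  set D := |(NumberField.discr K : ℝ)| with hD
  set G := Real.Gamma (2 + (n : ℝ) / 2)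
  have hG : 1 ≤ G := one_le_Gamma_two_add (by positivity)
  set ρ := 4 / ((n : ℝ) - 1) * Real.log ((n : ℝ) ^ (-(n : ℝ) / 2) * Real.sqrt D *
    (2 / π) ^ ((n : ℝ) / 2) * G) ^ 2
  have hρ : 0 ≤ ρ := mul_nonneg (div_nonneg (by norm_num) (by linarith)) (sq_nonneg _)
  have hpi : (0 : ℝ) < 2 / π := by positivity
  set η := Real.sqrt ((n : ℝ) - 1) / 2 * (2 / π) ^ (n - 1) *
    Real.Gamma (2 + ((n : ℝ) - 1) / 2) ^ 2 *
    (Real.sqrt (2 / (n : ℝ)) * (1 / 1000) *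
      (Real.log (Real.log (n : ℝ)) / Real.log (n : ℝ)) ^ 3) ^ ((2 : ℝ) - (n : ℝ)) * R with hηdef
  have hη : 1 * (1 / 2) ^ (n - 1) * 1 ^ 2 * 1000 ^ (n - 2) * R ≤ η := by
    have hs : 1 ≤ Real.sqrt ((n : ℝ) - 1) / 2 := by
      rw [le_div_iff₀ two_pos]
      exact Real.le_sqrt_of_sq_le (by linarith)
    have hg : 1 ≤ Real.Gamma (2 + ((n : ℝ) - 1) / 2) := one_le_Gamma_two_add (by linarith)
    have hp : (1 / 2 : ℝ) ^ (n - 1) ≤ (2 / π) ^ (n - 1) :=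
      pow_le_pow_left₀ (by norm_num) half_le_two_div_pi _
    have ht := thousand_pow_le hn
    rw [hηdef]
    gcongr ?_ * ?_ * ?_ ^ 2 * ?_ * R
  have hη0 : 0 ≤ η := le_trans (by positivity) hη
  have hpow : (1 / 2 : ℝ) ^ (n - 1) * 1000 ^ (n - 2) = 1 / 2 * (100 ^ (n - 2) * 5 ^ (n - 2)) := by
    rw [show n - 1 = (n - 2) + 1 by omega, pow_succ, ← mul_pow, mul_right_comm, ← mul_pow]
    norm_num [mul_comm]
  have h3 : (3 : ℝ) ^ (n - 2) ≤ 5 ^ (n - 2) := by gcongr; norm_num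
  have hmain : 4 * n * (R * 3 ^ (n - 2)) + 32 * n ^ 2 ≤ η := by
    refine le_trans ?_ hη
    have e1 : 32 * (n : ℝ) ^ 2 ≤ 32 * n ^ 2 * (R * 3 ^ (n - 1)) :=
      le_mul_of_one_le_right (by positivity) hR1
    have e2 : R * 3 ^ (n - 1) = 3 * (R * 3 ^ (n - 2)) := by
      rw [show n - 1 = (n - 2) + 1 by omega, pow_succ]; ring
    have e3 : 4 * n * (R * 3 ^ (n - 2)) ≤ 4 * (n : ℝ) ^ 2 * (R * 3 ^ (n - 2)) := by
      gcongr; nlinarith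
    calc _ ≤ 1 / 2 * (200 * (n : ℝ) ^ 2 * 3 ^ (n - 2)) * R := by
          rw [e2] at e1; linarith
      _ ≤ 1 / 2 * (100 ^ (n - 2) * 5 ^ (n - 2)) * R := by
          gcongr; exact two_hundred_mul_sq_le_pow hn
      _ = _ := by rw [← hpow]; ring
  have hsq : η ≤ Real.sqrt (η ^ 2 + ρ) := Real.le_sqrt_of_sq_le (by linarith)
  set F : ℝ := (2 * Real.sqrt D) ^ ((n : ℝ)⁻¹) with hF
  have hs1 : 1 ≤ Real.sqrt D := Real.one_le_sqrt.mpr hD1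
  have hF1 : 1 ≤ F := Real.one_le_rpow (by linarith) (by positivity)
  have hFn : F ^ n = 2 * Real.sqrt D := Real.rpow_inv_natCast_pow (by positivity) (by omega)
  have hcount := htr.numClasses_le htwo (F := F) (by linarith) (by rw [hdeg, hFn]; linarith)
  rw [hdeg] at hcount
  set E := Real.exp (4 * n * (R * 3 ^ (n - 2)))
  have hE : 1 ≤ E := Real.one_le_exp (by positivity)
  have hE32 : 32 * (n : ℝ) ^ 2 * E ≤ Real.exp η := by
    calc 32 * (n : ℝ) ^ 2 * E ≤ Real.exp (32 * (n : ℝ) ^ 2) * E := by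
          gcongr
          linarith [Real.add_one_le_exp (32 * (n : ℝ) ^ 2)]
      _ ≤ Real.exp η := by
          rw [← Real.exp_add]
          exact Real.exp_le_exp.mpr (by linarith)
  have hone : 1 ≤ (n : ℝ) * (n * E * F ^ 2) := by
    have : 1 ≤ F ^ 2 := one_le_pow₀ hF1
    have hn1 : (1 : ℝ) ≤ n := by linarith
    exact one_le_mul_of_one_le_of_one_le hn1
      (one_le_mul_of_one_le_of_one_le (one_le_mul_of_one_le_of_one_le hn1 hE) this)
  have h4 : (4 : ℝ) ≤ 4 ^ n := le_self_pow₀ (by norm_num) (by omega)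
  calc (numClasses K : ℝ) ≤ (n * (n * E * F ^ 2) + 1) ^ n := hcount
    _ ≤ (2 * n ^ 2 * E * F ^ 2) ^ n := by gcongr; linarith
    _ = (2 * n ^ 2 * E) ^ n * (4 * D) := by
      rw [mul_pow, ← pow_mul, mul_comm 2 n, pow_mul, hFn, mul_pow 2, Real.sq_sqrt (by linarith)]
      norm_num
    _ ≤ (2 * n ^ 2 * E) ^ n * (4 ^ n * D) := by gcongr
    _ = (32 * n ^ 2 * E) ^ n * D * (1 / 2) ^ (2 * n) := by
      rw [pow_mul, mul_right_comm _ D, ← mul_pow, ← mul_assoc, ← mul_pow]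
      congr 2
      ring
    _ ≤ Real.exp η ^ n * D * (2 / π) ^ (2 * n) * 1 ^ 4 := by
      rw [one_pow, mul_one]
      have hp : (1 / 2 : ℝ) ^ (2 * n) ≤ (2 / π) ^ (2 * n) :=
        pow_le_pow_left₀ (by norm_num) half_le_two_div_pi _
      gcongr ?_ ^ n * D * ?_
    _ ≤ _ := by
      rw [← Real.exp_nat_mul]
      gcongr
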